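/- For x ≫ 1 one has ∑_{k ≤ x} (−1)^k d(k) k^{1/2} = (1/3) x^{3/2} ( log x + 2γ − 2 log 2 − 2/3 ) + O(x^{5/6+ε}). -/

import Mathlib

open Complex Filter Real MeasureTheory Finset

noncomputable def chi (s : ℂ) : ℂ :=
  2 ^ s * (π : ℂ) ^ (s - 1) * Complex.sin (π * s / 2) * Complex.Gamma (1 - s)

noncomputable def Z (t : ℝ) : ℂ :=
  chi (1 / 2 + I * t) ^ (-(1 / 2 : ℂ)) * riemannZeta (1 / 2 + I * t)

/-- number of positive divisors -/
noncomputable def d (k : ℕ) : ℕ := k.divisors.card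

/-- number of ordered triples of positive integers with product `n` -/
noncomputable def d3 (n : ℕ) : ℕ :=
  ((Finset.Icc 1 n ×ˢ Finset.Icc 1 n ×ˢ Finset.Icc 1 n).filter
    fun p : ℕ × ℕ × ℕ => p.1 * p.2.1 * p.2.2 = n).card

/-- sum over integers `a ≤ k ≤ b` where terms at integer endpoints are halved -/
noncomputable def psum (a b : ℝ) (f : ℕ → ℂ) : ℂ :=
  ∑ k ∈ Finset.Icc ⌈a⌉₊ ⌊b⌋₊,
    (if (k : ℝ) = a ∨ (k : ℝ) = b then (1 / 2 : ℂ) else 1) * f k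

/-- The sawtooth function `{t} - 1/2`. -/
noncomputable def saw (t : ℝ) : ℝ := Int.fract t - 1 / 2

lemma abs_saw_le (t : ℝ) : |saw t| ≤ 1 / 2 := by
  have h₁ := Int.fract_nonneg t
  have h₂ := Int.fract_lt_one t
  rw [saw, abs_le]
  constructor <;> linarith

lemma natCast_mul_fract_sub_div (c : ℝ) (b : ℤ) {q : ℕ} (hq : 0 < q) :
    q * Int.fract (c - b / q) = Int.fract (q * c) + (((⌊q * c⌋ - b) % (q : ℤ) : ℤ) : ℝ) := by
  have hq' : (q : ℝ) ≠ 0 := by positivity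
  have h₁ : ⌊c - b / q⌋ = (⌊q * c⌋ - b) / (q : ℤ) := by
    rw [← Int.floor_sub_intCast, ← Int.floor_div_natCast]
    congr 1
    field_simp
  have h₂ : ((((⌊q * c⌋ - b) % (q : ℤ) : ℤ) : ℝ)) + q * (((⌊q * c⌋ - b) / (q : ℤ) : ℤ) : ℝ)
      = ⌊q * c⌋ - b := by
    exact_mod_cast Int.emod_add_mul_ediv (⌊q * c⌋ - b) (q : ℤ)
  rw [Int.fract, Int.fract, h₁, mul_sub, mul_sub]
  have h₃ : (q : ℝ) * (b / q) = b := by field_simp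
  linarith

lemma sum_emod_sub_mul (m a : ℤ) {q : ℕ} (hq : 0 < q) (hcop : IsCoprime a (q : ℤ)) :
    ∑ h ∈ range q, (m - h * a) % (q : ℤ) = ∑ h ∈ range q, (h : ℤ) := by
  have hq' : (0 : ℤ) < q := by exact_mod_cast hq
  have hcast (h : ℕ) : ((((m - h * a) % (q : ℤ)).toNat : ℕ) : ℤ) = (m - h * a) % (q : ℤ) :=
    Int.toNat_of_nonneg (Int.emod_nonneg _ hq'.ne')
  have hinj : Set.InjOn (fun h : ℕ => ((m - h * a) % (q : ℤ)).toNat) (range q) := by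
    intro h hh h' hh' e
    have e' : (m - h * a) % (q : ℤ) = (m - h' * a) % (q : ℤ) :=
      (hcast h).symm.trans ((congrArg (Nat.cast : ℕ → ℤ) e).trans (hcast h'))
    have h1 : (q : ℤ) ∣ ((h : ℤ) - h') * a := by
      have := Int.ModEq.dvd e'
      rwa [show m - h' * a - (m - h * a) = ((h : ℤ) - h') * a by ring] at this
    have h2 : (q : ℤ) ∣ (h : ℤ) - h' := hcop.symm.dvd_of_dvd_mul_right h1
    simp only [coe_range, Set.mem_Iio] at hh hh'
    have h3 : (h : ℤ) - h' = 0 := Int.eq_zero_of_abs_lt_dvd h2 (by rw [abs_lt]; omega)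
    omega
  have himg : (range q).image (fun h : ℕ => ((m - h * a) % (q : ℤ)).toNat) = range q := by
    apply Finset.eq_of_subset_of_card_le
    · intro y hy
      obtain ⟨h, -, rfl⟩ := Finset.mem_image.1 hy
      have := Int.emod_lt_of_pos (m - h * a) hq'
      have := hcast h
      simp only [Finset.mem_range]
      omega
    · rw [Finset.card_image_of_injOn hinj]
  conv_rhs => rw [← himg, Finset.sum_image hinj]
  exact Finset.sum_congr rfl fun h _ => (hcast h).symm

lemma sum_saw_sub_mul_div (c : ℝ) (a : ℤ) {q : ℕ} (hq : 0 < q) (hcop : IsCoprime a (q : ℤ)) :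
    ∑ h ∈ range q, saw (c - h * a / q) = saw (q * c) := by
  have hq' : (q : ℝ) ≠ 0 := by positivity
  have h₁ : ∀ h ∈ range q, saw (c - h * a / q) =
      (Int.fract (q * c) + (((⌊q * c⌋ - h * a) % (q : ℤ) : ℤ) : ℝ)) / q - 1 / 2 := by
    intro h _
    rw [← Int.cast_natCast h, ← Int.cast_mul, ← natCast_mul_fract_sub_div c _ hq, saw]
    field_simp
  have h₂ : ∑ h ∈ range q, (((⌊q * c⌋ - h * a) % (q : ℤ) : ℤ) : ℝ) = q * (q - 1) / 2 := by
    have := sum_emod_sub_mul ⌊q * c⌋ a hq hcop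
    rw [← Int.cast_sum, this]
    push_cast
    have h := Finset.sum_range_id_mul_two q
    have h' : (∑ i ∈ range q, (i : ℝ)) * 2 = q * (q - 1) := by
      rw [← Nat.cast_pred hq, ← Nat.cast_mul, ← h]; push_cast; rfl
    linarith
  rw [Finset.sum_congr rfl h₁, Finset.sum_sub_distrib, ← Finset.sum_div, Finset.sum_add_distrib, h₂]
  simp only [sum_const, card_range, nsmul_eq_mul, saw]
  field_simp
  ring

lemma abs_sum_saw_le {a : ℤ} {q : ℕ} (hq : 0 < q) (hcop : IsCoprime a (q : ℤ)) {c η : ℝ}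
    {t : ℕ → ℝ} (ht : ∀ h < q, |t h - (c - h * a / q)| ≤ η) :
    |∑ h ∈ range q, saw (t h)| ≤ 1 / 2 + 2 * η * q := by
  have hup : ∑ h ∈ range q, saw (t h) ≤ ∑ h ∈ range q, (saw (c - η - h * a / q) + 2 * η) := by
    refine Finset.sum_le_sum fun h hh => ?_
    have := abs_le.1 (ht h (Finset.mem_range.1 hh))
    have hf : ⌊c - η - h * a / q⌋ ≤ ⌊t h⌋ := Int.floor_le_floor (by linarith)
    have hf' : (⌊c - η - h * a / q⌋ : ℝ) ≤ ⌊t h⌋ := by exact_mod_cast hf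
    simp only [saw, Int.fract]
    linarith
  have hlo : ∑ h ∈ range q, (saw (c + η - h * a / q) - 2 * η) ≤ ∑ h ∈ range q, saw (t h) := by
    refine Finset.sum_le_sum fun h hh => ?_
    have := abs_le.1 (ht h (Finset.mem_range.1 hh))
    have hf : ⌊t h⌋ ≤ ⌊c + η - h * a / q⌋ := Int.floor_le_floor (by linarith)
    have hf' : (⌊t h⌋ : ℝ) ≤ ⌊c + η - h * a / q⌋ := by exact_mod_cast hf
    simp only [saw, Int.fract]
    linarith
  rw [Finset.sum_add_distrib, sum_saw_sub_mul_div _ a hq hcop] at hup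
  rw [Finset.sum_sub_distrib, sum_saw_sub_mul_div _ a hq hcop] at hlo
  simp only [sum_const, card_range, nsmul_eq_mul] at hup hlo
  have h₁ := abs_le.1 (abs_saw_le (q * (c - η)))
  have h₂ := abs_le.1 (abs_saw_le (q * (c + η)))
  rw [abs_le]
  constructor <;> nlinarith

lemma log_le_sub_inv_div_two {y : ℝ} (hy : 1 ≤ y) : Real.log y ≤ (y - y⁻¹) / 2 := by
  have h := Real.self_le_sinh_iff.2 (Real.log_nonneg hy)
  rwa [Real.sinh_eq, Real.exp_neg, Real.exp_log (by linarith)] at h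

lemma abs_harmonic_sub_log_sub_le (n : ℕ) (hn : 0 < n) :
    |(harmonic n : ℝ) - Real.log n - eulerMascheroniConstant - 1 / (2 * n)| ≤ 1 / (n : ℝ) ^ 2 := by
  set b : ℕ → ℝ := fun n => (harmonic (n + 1) : ℝ) - Real.log (n + 1 : ℕ) - 1 / (2 * (n + 1 : ℕ))
    with hb
  have hstep (n : ℕ) : b (n + 1) - b n = 1 / (2 * ((n : ℝ) + 1)) + 1 / (2 * ((n : ℝ) + 2))
      - Real.log (1 + 1 / ((n : ℝ) + 1)) := by
    have e : 1 + 1 / ((n : ℝ) + 1) = ((n : ℝ) + 2) / (n + 1) := by field_simp; ring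
    rw [e, Real.log_div (by positivity) (by positivity)]
    simp only [hb, harmonic_succ (n + 1)]
    push_cast
    rw [show (n : ℝ) + 1 + 1 = n + 2 by ring]
    field_simp
    ring
  have hlim1 : Tendsto (fun n : ℕ => 1 / ((n : ℝ) + 1)) atTop (nhds 0) :=
    tendsto_one_div_add_atTop_nhds_zero_nat
  have hlimb : Tendsto b atTop (nhds eulerMascheroniConstant) := by
    have h1 := (tendsto_add_atTop_iff_nat 1).2 tendsto_harmonic_sub_log
    have h2 := h1.sub (hlim1.mul_const (1 / 2))
    simp only [zero_mul, sub_zero] at h2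
    refine h2.congr fun n => ?_
    simp only [hb]
    push_cast
    field_simp
  have hmono : Monotone b := by
    refine monotone_nat_of_le_succ fun n => ?_
    have h := log_le_sub_inv_div_two (y := 1 + 1 / ((n : ℝ) + 1)) (by
      have : 0 ≤ 1 / ((n : ℝ) + 1) := by positivity
      linarith)
    have e : (1 + 1 / ((n : ℝ) + 1) - (1 + 1 / ((n : ℝ) + 1))⁻¹) / 2 =
        1 / (2 * ((n : ℝ) + 1)) + 1 / (2 * ((n : ℝ) + 2)) := by
      have e : 1 + 1 / ((n : ℝ) + 1) = ((n : ℝ) + 2) / (n + 1) := by field_simp; ring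
      rw [e]
      field_simp
      ring
    have := hstep n
    linarith
  have hanti : Antitone fun n => b n + (1 / ((n : ℝ) + 1)) ^ 2 := by
    refine antitone_nat_of_succ_le fun n => ?_
    have h := Real.le_log_one_add_of_nonneg (x := 1 / ((n : ℝ) + 1)) (by positivity)
    have h' := hstep n
    have e : 1 / (2 * ((n : ℝ) + 1)) + 1 / (2 * ((n : ℝ) + 2))
        - 2 * (1 / ((n : ℝ) + 1)) / (1 / ((n : ℝ) + 1) + 2)
        = 1 / (2 * (n + 1) * (n + 2) * (2 * n + 3)) := by
      have : 1 / ((n : ℝ) + 1) + 2 = (2 * n + 3) / (n + 1) := by field_simp; ring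
      rw [this]
      field_simp
      ring
    have e2 : (1 / ((n : ℝ) + 1)) ^ 2 - (1 / ((n : ℝ) + 2)) ^ 2
        - 1 / (2 * (n + 1) * (n + 2) * (2 * n + 3))
        = (2 * (2 * n + 3) ^ 2 - (n + 1) * (n + 2)) /
          (2 * (n + 1) ^ 2 * (n + 2) ^ 2 * (2 * n + 3)) := by
      field_simp
      ring
    have e3 : 0 ≤ (2 * (2 * (n : ℝ) + 3) ^ 2 - (n + 1) * (n + 2)) /
          (2 * (n + 1) ^ 2 * (n + 2) ^ 2 * (2 * n + 3)) := by
      apply div_nonneg _ (by positivity)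
      have : (0 : ℝ) ≤ n := by positivity
      nlinarith
    push_cast
    rw [show (n : ℝ) + 1 + 1 = n + 2 by ring]
    linarith
  have hlim2 : Tendsto (fun n => b n + (1 / ((n : ℝ) + 1)) ^ 2) atTop
      (nhds eulerMascheroniConstant) := by
    simpa using hlimb.add (hlim1.pow 2)
  obtain ⟨m, rfl⟩ := Nat.exists_eq_succ_of_ne_zero hn.ne'
  have h1 := hmono.ge_of_tendsto hlimb m
  have h2 := hanti.le_of_tendsto hlim2 m
  simp only [hb] at h1 h2
  have h3 : (0 : ℝ) ≤ 1 / ((m : ℝ) + 1) ^ 2 := by positivity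
  rw [Nat.succ_eq_add_one, abs_le]
  push_cast at *
  rw [one_div_pow] at h2
  constructor <;> linarith

lemma exists_abs_sum_saw_div_le {x : ℝ} (hx : 0 < x) {N T n : ℕ} (hT : 0 < T)
    (hNT : x * T ^ 3 ≤ N ^ 3) (hn : N ≤ n) :
    ∃ r : ℚ, r.den ≤ T ∧ |x / n ^ 2 - r| ≤ 1 / ((T + 1) * r.den) ∧
      |∑ h ∈ range r.den, saw (x / ((n + h : ℕ) : ℝ))| ≤ 9 / 2 := by
  obtain ⟨r, hr, hrT⟩ := Real.exists_rat_abs_sub_le_and_den_le (x / n ^ 2) hT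
  refine ⟨r, hrT, hr, ?_⟩
  have hT' : (0 : ℝ) < T := by exact_mod_cast hT
  have hN : (0 : ℝ) < N := by
    have h : (0 : ℝ) < (N : ℝ) ^ 3 := lt_of_lt_of_le (by positivity) hNT
    exact lt_of_pow_lt_pow_left₀ 3 N.cast_nonneg (by simpa using h)
  have hn' : (N : ℝ) ≤ n := by exact_mod_cast hn
  have hn0 : (0 : ℝ) < n := hN.trans_le hn'
  have hq : (0 : ℝ) < r.den := by exact_mod_cast r.pos
  have hqT : (r.den : ℝ) ≤ T := by exact_mod_cast hrT
  have hcop : IsCoprime r.num (r.den : ℤ) := by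
    rw [Int.isCoprime_iff_nat_coprime]; simpa using r.reduced
  have key := abs_sum_saw_le (c := x / n) (η := 2 / r.den)
    (t := fun h => x / ((n + h : ℕ) : ℝ)) r.pos hcop ?_
  · refine key.trans (le_of_eq ?_)
    field_simp
    norm_num
  intro h hh
  have hh' : (h : ℝ) ≤ r.den := by exact_mod_cast hh.le
  have e : x / ((n + h : ℕ) : ℝ) - (x / n - h * r.num / r.den)
      = -(h * (x / n ^ 2 - r)) + h ^ 2 * x / (n ^ 2 * (n + h)) := by
    have : (r : ℝ) = r.num / r.den := Rat.cast_def r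
    rw [this]
    push_cast
    field_simp
    ring
  have h1 : |-((h : ℝ) * (x / n ^ 2 - r))| ≤ 1 / r.den := by
    rw [abs_neg, abs_mul, Nat.abs_cast]
    calc (h : ℝ) * |x / n ^ 2 - r| ≤ r.den * (1 / ((T + 1) * r.den)) := by gcongr
      _ = 1 / (T + 1) := by field_simp
      _ ≤ 1 / r.den := by gcongr; linarith
  have h2 : |(h : ℝ) ^ 2 * x / (n ^ 2 * (n + h))| ≤ 1 / r.den := by
    rw [abs_of_nonneg (by positivity)]
    calc (h : ℝ) ^ 2 * x / (n ^ 2 * (n + h)) ≤ r.den ^ 2 * x / (N ^ 2 * N) := by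
          gcongr; linarith
      _ = r.den ^ 2 * x / N ^ 3 := by ring
      _ ≤ r.den ^ 2 * x / (x * T ^ 3) := by gcongr
      _ = r.den ^ 2 / T ^ 3 := by field_simp
      _ ≤ r.den ^ 2 / r.den ^ 3 := by gcongr
      _ = 1 / r.den := by field_simp
  rw [e]
  calc _ ≤ _ := abs_add_le _ _
    _ ≤ 1 / (r.den : ℝ) + 1 / r.den := add_le_add h1 h2
    _ = _ := by ring

/-- Cutting `[n, M)` greedily into blocks on which `f` has a bounded sum. -/
lemma exists_abs_sum_Ico_le {f : ℕ → ℝ} (hf : ∀ k, |f k| ≤ 1) {q : ℕ → ℕ} {N T : ℕ} {C : ℝ}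
    (hq0 : ∀ n, N ≤ n → 0 < q n) (hqT : ∀ n, N ≤ n → q n ≤ T)
    (hsum : ∀ n, N ≤ n → |∑ h ∈ range (q n), f (n + h)| ≤ C) (M n : ℕ) (hn : N ≤ n) :
    ∃ G ⊆ Ico n M, (∀ g ∈ G, ∀ g' ∈ G, g < g' → g + q g ≤ g') ∧
      |∑ k ∈ Ico n M, f k| ≤ C * #G + T := by
  induction hk : M - n using Nat.strong_induction_on generalizing n with
  | _ k ih =>
    by_cases hlt : M < n + q n
    · refine ⟨∅, by simp, by simp, ?_⟩
      have h1 : |∑ k ∈ Ico n M, f k| ≤ ∑ k ∈ Ico n M, (1 : ℝ) :=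
        (Finset.abs_sum_le_sum_abs _ _).trans (Finset.sum_le_sum fun k _ => hf k)
      have h2 : ((M - n : ℕ) : ℝ) ≤ T := by
        have := hqT n hn
        exact_mod_cast (by omega : M - n ≤ T)
      simp only [sum_const, Nat.card_Ico, nsmul_eq_mul, mul_one] at h1
      simp only [card_empty, Nat.cast_zero, mul_zero, zero_add]
      linarith
    · push Not at hlt
      have h0 := hq0 n hn
      obtain ⟨G, hG, hsp, hb⟩ := ih (M - (n + q n)) (by omega) (n + q n) (by omega) rfl
      have hmem : ∀ g ∈ G, n + q n ≤ g ∧ g < M := fun g hg => Finset.mem_Ico.1 (hG hg)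
      have hnot : n ∉ G := fun h => by have := hmem n h; omega
      refine ⟨insert n G, ?_, ?_, ?_⟩
      · intro g hg
        rcases Finset.mem_insert.1 hg with rfl | hg
        · simp only [Finset.mem_Ico]; omega
        · have := hmem g hg
          simp only [Finset.mem_Ico]; omega
      · intro g hg g' hg' hlt'
        rcases Finset.mem_insert.1 hg with rfl | hgG <;>
          rcases Finset.mem_insert.1 hg' with rfl | hgG'
        · omega
        · exact (hmem g' hgG').1
        · have := (hmem g hgG).1
          omega
        · exact hsp g hgG g' hgG' hlt'
      · rw [← Finset.sum_Ico_consecutive f (Nat.le_add_right n (q n)) hlt,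
          Finset.sum_Ico_eq_sum_range, Nat.add_sub_cancel_left, Finset.card_insert_of_notMem hnot]
        have h1 := hsum n hn
        have h2 := abs_add_le (∑ h ∈ range (q n), f (n + h)) (∑ k ∈ Ico (n + q n) M, f k)
        push_cast
        linarith

lemma card_le_of_spaced {S : Finset ℕ} {q : ℕ} (hq : 0 < q) {L : ℝ} (hL : 0 ≤ L)
    (hsp : ∀ g ∈ S, ∀ g' ∈ S, g < g' → g + q ≤ g')
    (hS : ∀ g ∈ S, ∀ g' ∈ S, g < g' → (g' : ℝ) - g ≤ L) : (#S : ℝ) ≤ L / q + 1 := by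
  have hq' : (0 : ℝ) < q := by exact_mod_cast hq
  rcases S.eq_empty_or_nonempty with rfl | hne
  · simp only [card_empty, Nat.cast_zero]; positivity
  set m := S.min' hne with hm
  have hmS : m ∈ S := S.min'_mem hne
  have hmle : ∀ g ∈ S, m ≤ g := fun g hg => S.min'_le g hg
  have hmono : ∀ g ∈ S, ∀ g' ∈ S, g < g' → (g - m) / q < (g' - m) / q := by
    intro g hg g' hg' hlt
    have h1 := hsp g hg g' hg' hlt
    have h2 := hmle g hg
    calc (g - m) / q < (g - m) / q + 1 := Nat.lt_succ_self _
      _ = (g - m + q) / q := (Nat.add_div_right _ hq).symm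
      _ ≤ (g' - m) / q := Nat.div_le_div_right (by omega)
  have hcard : #S ≤ #(range (⌊L / q⌋₊ + 1)) := by
    apply Finset.card_le_card_of_injOn (fun g => (g - m) / q)
    · intro g hg
      have hg : g ∈ S := hg
      simp only [coe_range, Set.mem_Iio, Nat.lt_succ_iff]
      apply Nat.le_floor
      have h1 : (((g - m) / q : ℕ) : ℝ) ≤ ((g - m : ℕ) : ℝ) / q := Nat.cast_div_le
      refine h1.trans ?_
      gcongr
      rw [Nat.cast_sub (hmle g hg)]
      rcases (hmle g hg).eq_or_lt with h | h
      · rw [← h]; simpa using hL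
      · exact hS m hmS g hg h
    · intro g hg g' hg' e
      by_contra hne
      rcases Nat.lt_or_gt_of_ne hne with h | h
      · exact (hmono g hg g' hg' h).ne e
      · exact (hmono g' hg' g hg h).ne' e
  rw [card_range] at hcard
  have h1 : (#S : ℝ) ≤ ⌊L / q⌋₊ + 1 := by exact_mod_cast hcard
  have h2 : (⌊L / q⌋₊ : ℝ) ≤ L / q := Nat.floor_le (by positivity)
  linarith

lemma card_spaced_near_le {S : Finset ℕ} {q N : ℕ} (hq : 0 < q) (hN : 0 < N) {x α δ : ℝ}
    (hx : 0 < x) (hδ : 0 ≤ δ) (hSN : ∀ g ∈ S, N ≤ g ∧ g ≤ 2 * N)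
    (hsp : ∀ g ∈ S, ∀ g' ∈ S, g < g' → g + q ≤ g')
    (hS : ∀ g ∈ S, |x / g ^ 2 - α| ≤ δ) : (#S : ℝ) ≤ 16 * N ^ 3 * δ / x / q + 1 := by
  refine card_le_of_spaced hq (by positivity) hsp fun g hg g' hg' hlt => ?_
  obtain ⟨h1, h2⟩ := hSN g hg
  obtain ⟨h3, h4⟩ := hSN g' hg'
  have hN' : (0 : ℝ) < N := by exact_mod_cast hN
  have h1' : (N : ℝ) ≤ g := by exact_mod_cast h1
  have h2' : (g : ℝ) ≤ 2 * N := by exact_mod_cast h2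
  have h4' : (g' : ℝ) ≤ 2 * N := by exact_mod_cast h4
  have hlt' : (g : ℝ) < g' := by exact_mod_cast hlt
  have hg0 : (0 : ℝ) < g := hN'.trans_le h1'
  have hg0' : (0 : ℝ) < g' := hg0.trans hlt'
  have hd : x / g ^ 2 - x / g' ^ 2 ≤ 2 * δ := by
    have a1 := abs_le.1 (hS g hg)
    have a2 := abs_le.1 (hS g' hg')
    linarith
  have e : x / g ^ 2 - x / g' ^ 2 = x * (g' - g) * ((g + g') / (g ^ 2 * g' ^ 2)) := by
    field_simp
    ring
  have h8 : 1 / (8 * (N : ℝ) ^ 3) ≤ (g + g') / (g ^ 2 * g' ^ 2) := by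
    calc 1 / (8 * (N : ℝ) ^ 3) = 1 / ((2 * (N : ℝ)) * (2 * N) ^ 2) := by ring
      _ ≤ 1 / ((g : ℝ) * g' ^ 2) := by gcongr
      _ = (g : ℝ) / (g ^ 2 * g' ^ 2) := by field_simp
      _ ≤ (g + g') / (g ^ 2 * g' ^ 2) := by gcongr; linarith
  have h9 : x * (g' - g) * (1 / (8 * (N : ℝ) ^ 3)) ≤ 2 * δ := by
    refine le_trans ?_ (e ▸ hd)
    have : 0 ≤ x * ((g' : ℝ) - g) := mul_nonneg hx.le (by linarith)
    gcongr
  rw [mul_one_div, div_le_iff₀ (by positivity)] at h9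
  rw [le_div_iff₀ hx]
  linarith

lemma card_starts_le {x w : ℝ} (hw : 1 ≤ w) (hxw : x = w ^ 3) {N T : ℕ} (hT : 0 < T)
    (hTN : T * w ≤ N) (hNT : N ≤ 2 * T * w) (hNx : (N : ℝ) ^ 2 ≤ x) {r : ℕ → ℚ} {G : Finset ℕ}
    (hG : ∀ g ∈ G, N ≤ g ∧ g ≤ 2 * N) (hrT : ∀ g ∈ G, (r g).den ≤ T)
    (hr : ∀ g ∈ G, |x / g ^ 2 - r g| ≤ 1 / ((T + 1) * (r g).den))
    (hsp : ∀ g ∈ G, ∀ g' ∈ G, g < g' → g + (r g).den ≤ g') :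
    (#G : ℝ) ≤ 387 * w * (1 + Real.log T) := by
  have hT' : (1 : ℝ) ≤ T := by exact_mod_cast hT
  have hw0 : 0 < w := by linarith
  have hx : 0 < x := by rw [hxw]; positivity
  have hN' : (0 : ℝ) < N := lt_of_lt_of_le (by positivity) hTN
  have hN : 0 < N := by exact_mod_cast hN'
  have hxN : x / N ^ 2 ≤ w / T ^ 2 := by
    rw [div_le_div_iff₀ (by positivity) (by positivity), hxw]
    calc w ^ 3 * T ^ 2 = w * (T * w) ^ 2 := by ring
      _ ≤ w * N ^ 2 := by gcongr
  have hxN1 : 1 ≤ x / N ^ 2 := by rwa [le_div_iff₀ (by positivity), one_mul]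
  have hfib : ∀ q ∈ Icc 1 T, ∀ a : ℤ,
      (#{g ∈ {g ∈ G | (r g).den = q} | (r g).num = a} : ℝ) ≤ 129 * T ^ 2 / q ^ 2 := by
    intro q hq a
    obtain ⟨hq1, hqT⟩ := Finset.mem_Icc.1 hq
    have hq1' : (1 : ℝ) ≤ q := by exact_mod_cast hq1
    have hqT' : (q : ℝ) ≤ T := by exact_mod_cast hqT
    have h := card_spaced_near_le (S := {g ∈ {g ∈ G | (r g).den = q} | (r g).num = a}) (q := q)
      (α := a / q) (δ := 1 / ((T + 1) * q)) hq1 hN hx (by positivity) ?_ ?_ ?_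
    · refine h.trans ?_
      have h1 : 16 * (N : ℝ) ^ 3 * (1 / ((T + 1) * q)) / x / q ≤ 128 * (T : ℝ) ^ 2 / q ^ 2 := by
        calc 16 * (N : ℝ) ^ 3 * (1 / ((T + 1) * q)) / x / q
            ≤ 16 * (2 * T * w) ^ 3 * (1 / ((T : ℝ) * q)) / x / q := by gcongr; linarith
          _ = 128 * (T : ℝ) ^ 2 / q ^ 2 := by rw [hxw]; field_simp; norm_num
      have h2 : (1 : ℝ) ≤ (T : ℝ) ^ 2 / q ^ 2 := by
        rw [le_div_iff₀ (by positivity), one_mul]; gcongr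
      have h3 : 129 * (T : ℝ) ^ 2 / q ^ 2 = 128 * T ^ 2 / q ^ 2 + T ^ 2 / q ^ 2 := by ring
      linarith
    · intro g hg
      simp only [Finset.mem_filter] at hg
      exact hG g hg.1.1
    · intro g hg g' hg' hlt
      simp only [Finset.mem_filter] at hg hg'
      have := hsp g hg.1.1 g' hg'.1.1 hlt
      rwa [hg.1.2] at this
    · intro g hg
      simp only [Finset.mem_filter] at hg
      have := hr g hg.1.1
      rwa [Rat.cast_def, hg.1.2, hg.2] at this
  have hden : ∀ q ∈ Icc 1 T, (#{g ∈ G | (r g).den = q} : ℝ) ≤ 387 * w * (q : ℝ)⁻¹ := by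
    intro q hq
    obtain ⟨hq1, hqT⟩ := Finset.mem_Icc.1 hq
    have hq1' : (1 : ℝ) ≤ q := by exact_mod_cast hq1
    have hmaps : ∀ g ∈ ({g ∈ G | (r g).den = q} : Finset ℕ),
        (r g).num ∈ Icc (0 : ℤ) (⌊q * (x / N ^ 2)⌋ + 1) := by
      intro g hg
      simp only [Finset.mem_filter] at hg
      obtain ⟨hgG, hgq⟩ := hg
      have h1 := hr g hgG
      have hgN : (N : ℝ) ≤ g := by exact_mod_cast (hG g hgG).1
      have hg0 : (0 : ℝ) < g := hN'.trans_le hgN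
      rw [Rat.cast_def, hgq] at h1
      have h2 : |q * (x / g ^ 2) - (r g).num| ≤ 1 / (T + 1) := by
        have e : q * (x / g ^ 2) - (r g).num = q * (x / g ^ 2 - (r g).num / q) := by field_simp
        rw [e, abs_mul, Nat.abs_cast]
        calc (q : ℝ) * |x / g ^ 2 - (r g).num / q| ≤ q * (1 / ((T + 1) * q)) := by gcongr
          _ = 1 / (T + 1) := by field_simp
      have h3 : 1 / ((T : ℝ) + 1) < 1 := by rw [div_lt_one (by positivity)]; linarith
      have h4 := abs_le.1 h2
      have h5 : 0 ≤ q * (x / g ^ 2) := by positivity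
      have h6 : q * (x / g ^ 2) ≤ q * (x / N ^ 2) := by gcongr
      rw [Finset.mem_Icc]
      constructor
      · have : (-1 : ℝ) < (r g).num := by linarith
        have : (-1 : ℤ) < (r g).num := by exact_mod_cast this
        omega
      · rw [← sub_le_iff_le_add, Int.le_floor]
        push_cast
        linarith
    rw [Finset.card_eq_sum_card_fiberwise hmaps]
    push_cast
    have hq0 : 0 ≤ ⌊q * (x / N ^ 2)⌋ := Int.floor_nonneg.2 (by positivity)
    calc _ ≤ ∑ a ∈ Icc (0 : ℤ) (⌊q * (x / N ^ 2)⌋ + 1), 129 * (T : ℝ) ^ 2 / q ^ 2 :=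
          Finset.sum_le_sum fun a _ => hfib q hq a
      _ = ((⌊q * (x / N ^ 2)⌋ : ℝ) + 2) * (129 * T ^ 2 / q ^ 2) := by
          rw [sum_const, Int.card_Icc, nsmul_eq_mul, ← Int.cast_natCast,
            Int.toNat_of_nonneg (by omega)]
          push_cast
          ring
      _ ≤ (3 * (q * (w / T ^ 2))) * (129 * T ^ 2 / q ^ 2) := by
          gcongr
          have h1 := Int.floor_le (q * (x / N ^ 2))
          have h2 : q * (x / N ^ 2) ≤ q * (w / T ^ 2) := by gcongr
          have h3 : 1 ≤ q * (x / N ^ 2) := one_le_mul_of_one_le_of_one_le hq1' hxN1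
          linarith
      _ = 387 * w * (q : ℝ)⁻¹ := by field_simp; norm_num
  have hmaps : ∀ g ∈ G, (r g).den ∈ Icc 1 T := fun g hg =>
    Finset.mem_Icc.2 ⟨(r g).pos, hrT g hg⟩
  rw [Finset.card_eq_sum_card_fiberwise hmaps]
  push_cast
  calc _ ≤ ∑ q ∈ Icc 1 T, 387 * w * (q : ℝ)⁻¹ := Finset.sum_le_sum hden
    _ = 387 * w * (harmonic T : ℝ) := by
        rw [← Finset.mul_sum, harmonic_eq_sum_Icc]; push_cast; rfl
    _ ≤ _ := by gcongr; exact harmonic_le_one_add_log T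

lemma abs_sum_Ico_saw_div_le {x w : ℝ} (hw : 1 ≤ w) (hxw : x = w ^ 3) {N T M : ℕ} (hT : 0 < T)
    (hTN : T * w ≤ N) (hNT : N ≤ 2 * T * w) (hNx : (N : ℝ) ^ 2 ≤ x) (hM : M ≤ 2 * N + 1) :
    |∑ k ∈ Ico N M, saw (x / k)| ≤ 2000 * w * (1 + Real.log T) + T := by
  have hw0 : 0 < w := by linarith
  have hx : 0 < x := by rw [hxw]; positivity
  have h3 : x * T ^ 3 ≤ N ^ 3 := by
    rw [hxw, ← mul_pow, mul_comm]; gcongr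
  choose! r hrT hr hsum using fun n (hn : N ≤ n) => exists_abs_sum_saw_div_le hx hT h3 hn
  obtain ⟨G, hG, hsp, hb⟩ := exists_abs_sum_Ico_le (f := fun k => saw (x / k))
    (fun k => (abs_saw_le _).trans (by norm_num)) (q := fun n => (r n).den) (C := 9 / 2)
    (fun n _ => (r n).pos) hrT hsum M N le_rfl
  have hmem : ∀ g ∈ G, N ≤ g ∧ g ≤ 2 * N := fun g hg => by
    have := Finset.mem_Ico.1 (hG hg); omega
  have hc := card_starts_le hw hxw hT hTN hNT hNx hmem (fun g hg => hrT g (hmem g hg).1)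
    (fun g hg => hr g (hmem g hg).1) hsp
  have hlog : 0 ≤ w * (1 + Real.log T) :=
    mul_nonneg hw0.le (add_nonneg zero_le_one (Real.log_natCast_nonneg T))
  linarith

lemma abs_sum_saw_div_le_log {x w : ℝ} (hw : 1 ≤ w) (hxw : x = w ^ 3) (M : ℕ)
    (hM : (M : ℝ) ^ 2 ≤ x) :
    |∑ k ∈ Ico 1 (M + 1), saw (x / k)| ≤ w + 2001 * w * (1 + Real.log w) * Nat.log 2 M := by
  have hw0 : 0 < w := by linarith
  have hlogw : 0 ≤ Real.log w := Real.log_nonneg hw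
  induction M using Nat.strong_induction_on with
  | _ M ih =>
    by_cases hsmall : (M : ℝ) ≤ 2 * w
    · have h1 : |∑ k ∈ Ico 1 (M + 1), saw (x / k)| ≤ ∑ k ∈ Ico 1 (M + 1), (1 / 2 : ℝ) :=
        (Finset.abs_sum_le_sum_abs _ _).trans (Finset.sum_le_sum fun k _ => abs_saw_le _)
      simp only [sum_const, Nat.card_Ico, nsmul_eq_mul, Nat.add_sub_cancel] at h1
      have h2 : 0 ≤ 2001 * w * (1 + Real.log w) * Nat.log 2 M := by positivity
      linarith
    · push Not at hsmall
      have hM2 : 2 ≤ M := by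
        have : (2 : ℝ) < M := by linarith
        exact_mod_cast this.le
      set N := M / 2 + 1 with hN
      have hMN : (M : ℝ) ≤ 2 * N := by exact_mod_cast (by omega : M ≤ 2 * N)
      have hNM : (N : ℝ) ≤ M := by exact_mod_cast (by omega : N ≤ M)
      have hM2' : ((M / 2 : ℕ) : ℝ) ≤ M := by exact_mod_cast Nat.div_le_self M 2
      have hNx : (N : ℝ) ^ 2 ≤ x := le_trans (by gcongr) hM
      have hwN : 1 ≤ N / w := by rw [le_div_iff₀ hw0]; linarith
      set T := ⌊N / w⌋₊ with hTdef
      have hT : 0 < T := Nat.floor_pos.2 hwN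
      have hT1 : (1 : ℝ) ≤ T := by exact_mod_cast hT
      have hTle : (T : ℝ) ≤ N / w := Nat.floor_le (by positivity)
      have hTN : T * w ≤ N := (le_div_iff₀ hw0).1 hTle
      have hNT : N ≤ 2 * T * w := by
        have h1 := Nat.lt_floor_add_one ((N : ℝ) / w)
        rw [← hTdef, div_lt_iff₀ hw0] at h1
        nlinarith
      have hTw : (T : ℝ) ≤ w := by
        have h1 : (T * w) ^ 2 ≤ w ^ 3 := hxw ▸ (pow_le_pow_left₀ (by positivity) hTN 2).trans hNx
        have h2 : (T : ℝ) ^ 2 ≤ w := by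
          refine le_of_mul_le_mul_right ?_ (pow_pos hw0 2)
          linarith
        nlinarith
      have hlog : Real.log T ≤ Real.log w := Real.log_le_log (by positivity) hTw
      have hblock := abs_sum_Ico_saw_div_le hw hxw hT hTN hNT hNx
        (M := M + 1) (by omega)
      have hrec := ih (M / 2) (by omega) (le_trans (by gcongr) hM)
      have hl : Nat.log 2 M = Nat.log 2 (M / 2) + 1 := by
        rw [Nat.log_div_base, Nat.sub_add_cancel (Nat.log_pos one_lt_two hM2)]
      rw [← Finset.sum_Ico_consecutive _ (show 1 ≤ M / 2 + 1 by omega)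
        (show M / 2 + 1 ≤ M + 1 by omega), hl]
      refine (abs_add_le _ _).trans ?_
      have h3 : 2000 * w * (1 + Real.log T) ≤ 2000 * w * (1 + Real.log w) := by gcongr
      push_cast
      nlinarith

lemma abs_sum_saw_div_le_sq_log {x w : ℝ} (hw : 1 ≤ w) (hxw : x = w ^ 3) (M : ℕ)
    (hM : (M : ℝ) ^ 2 ≤ x) :
    |∑ k ∈ Ico 1 (M + 1), saw (x / k)| ≤ 6004 * w * (1 + Real.log w) ^ 2 := by
  have hw0 : 0 < w := by linarith
  have hlogw : 0 ≤ Real.log w := Real.log_nonneg hw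
  refine (abs_sum_saw_div_le_log hw hxw M hM).trans ?_
  have h1 : (Nat.log 2 M : ℝ) ≤ 3 * (1 + Real.log w) := by
    rcases Nat.eq_zero_or_pos M with rfl | hpos
    · simp only [Nat.log_zero_right, Nat.cast_zero]; positivity
    have h2 : (2 : ℝ) ^ Nat.log 2 M ≤ M := by exact_mod_cast Nat.pow_log_le_self 2 hpos.ne'
    have h3 := Real.log_le_log (by positivity) h2
    have hM0 : (0 : ℝ) < M := by exact_mod_cast hpos
    have h4 := Real.log_le_log (by positivity) hM
    rw [Real.log_pow] at h3
    rw [hxw, Real.log_pow, Real.log_pow] at h4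
    push_cast at h4
    have h5 := Real.log_two_gt_d9
    have h6 : (0 : ℝ) ≤ Nat.log 2 M := by positivity
    nlinarith
  have h2 : 2001 * w * (1 + Real.log w) * Nat.log 2 M
      ≤ 2001 * w * (1 + Real.log w) * (3 * (1 + Real.log w)) := by gcongr
  have h3 : w ≤ w * (1 + Real.log w) ^ 2 := le_mul_of_one_le_right hw0.le (by nlinarith)
  nlinarith

/-- The summatory function of the divisor function. -/
noncomputable def divisorSum (n : ℕ) : ℕ := ∑ k ∈ Ioc 0 n, d k

lemma divisorSum_eq_sum_div (n : ℕ) : divisorSum n = ∑ k ∈ Ioc 0 n, n / k := by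
  rw [← ArithmeticFunction.sum_Ioc_sigma0_eq_sum_div]
  simp only [divisorSum, d, ArithmeticFunction.sigma_zero_apply]

lemma card_filter_mul_le {m k n : ℕ} (hk : 0 < k) (h : n / k ≤ m) :
    #{b ∈ Ioc 0 m | k * b ≤ n} = n / k := by
  rw [show ({b ∈ Ioc 0 m | k * b ≤ n} : Finset ℕ) = Ioc 0 (n / k) by
    ext b
    simp only [Finset.mem_filter, Finset.mem_Ioc, Nat.le_div_iff_mul_le hk, mul_comm k]
    constructor
    · rintro ⟨⟨h1, -⟩, h2⟩; exact ⟨h1, h2⟩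
    · rintro ⟨h1, h2⟩
      exact ⟨⟨h1, ((Nat.le_div_iff_mul_le hk).2 h2).trans h⟩, h2⟩]
  simp

/-- The Dirichlet hyperbola method. -/
lemma divisorSum_add_sqrt_sq (n : ℕ) :
    divisorSum n + n.sqrt ^ 2 = 2 * ∑ k ∈ Ioc 0 n.sqrt, n / k := by
  set m := n.sqrt with hm
  have hmn : m ≤ n := Nat.sqrt_le_self n
  have hm1 : n < (m + 1) * (m + 1) := Nat.lt_succ_sqrt n
  have hm2 : m * m ≤ n := Nat.sqrt_le n
  have hsplit : divisorSum n = ∑ k ∈ Ioc 0 m, n / k + ∑ k ∈ Ioc m n, n / k := by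
    rw [divisorSum_eq_sum_div, Finset.sum_Ioc_consecutive _ (Nat.zero_le m) hmn]
  have htail : ∑ k ∈ Ioc m n, n / k = ∑ b ∈ Ioc 0 m, (n / b - m) := by
    have h1 : ∀ k ∈ Ioc m n, n / k = #{b ∈ Ioc 0 m | k * b ≤ n} := by
      intro k hk
      obtain ⟨hk1, -⟩ := Finset.mem_Ioc.1 hk
      refine (card_filter_mul_le (by omega) ?_).symm
      rw [← Nat.lt_succ_iff, Nat.div_lt_iff_lt_mul (by omega)]
      calc n < (m + 1) * (m + 1) := hm1
        _ ≤ (m + 1) * k := Nat.mul_le_mul_left _ hk1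
    have h2 : ∀ b ∈ Ioc 0 m, n / b - m = #{k ∈ Ioc m n | k * b ≤ n} := by
      intro b hb
      obtain ⟨hb1, -⟩ := Finset.mem_Ioc.1 hb
      rw [show ({k ∈ Ioc m n | k * b ≤ n} : Finset ℕ) = Ioc m (n / b) by
        ext k
        simp only [Finset.mem_filter, Finset.mem_Ioc, Nat.le_div_iff_mul_le hb1]
        constructor
        · rintro ⟨⟨h1, -⟩, h2⟩; exact ⟨h1, h2⟩
        · rintro ⟨h1, h2⟩
          exact ⟨⟨h1, (Nat.le_mul_of_pos_right k hb1).trans h2⟩, h2⟩]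
      simp
    rw [Finset.sum_congr rfl h1, Finset.sum_congr rfl h2]
    simp only [Finset.card_filter]
    exact Finset.sum_comm
  have hadd : ∑ b ∈ Ioc 0 m, (n / b - m) + m ^ 2 = ∑ b ∈ Ioc 0 m, n / b := by
    have : m ^ 2 = ∑ b ∈ Ioc 0 m, m := by simp [sq]
    rw [this, ← Finset.sum_add_distrib]
    refine Finset.sum_congr rfl fun b hb => Nat.sub_add_cancel ?_
    obtain ⟨hb1, hb2⟩ := Finset.mem_Ioc.1 hb
    rw [Nat.le_div_iff_mul_le hb1]
    exact (Nat.mul_le_mul_left m hb2).trans hm2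
  omega

lemma abs_hyperbola_main_le {x : ℝ} {m : ℕ} (hm : 0 < m) (h1 : (m : ℝ) ^ 2 ≤ x)
    (h2 : x < ((m : ℝ) + 1) ^ 2) :
    |2 * x * Real.log m + x / m - m - m ^ 2 - (x * Real.log x - x)| ≤ 5 := by
  have hm1 : (1 : ℝ) ≤ m := by exact_mod_cast hm
  have hm0 : (0 : ℝ) < m := by linarith
  have hx : 0 < x := lt_of_lt_of_le (by positivity) h1
  obtain ⟨s, hs, rfl⟩ : ∃ s : ℝ, 0 < s ∧ x = s ^ 2 :=
    ⟨√x, Real.sqrt_pos.2 hx, (Real.sq_sqrt hx.le).symm⟩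
  have hms : (m : ℝ) ≤ s := (pow_le_pow_iff_left₀ hm0.le hs.le two_ne_zero).1 h1
  have hsm : s < m + 1 := (pow_lt_pow_iff_left₀ hs.le (by positivity) two_ne_zero).1 h2
  obtain ⟨θ, rfl⟩ : ∃ θ, s = m + θ := ⟨s - m, by ring⟩
  have hθ0 : 0 ≤ θ := by linarith
  have hθ1 : θ < 1 := by linarith
  have hlog : 2 * (m + θ) ^ 2 * Real.log m - (m + θ) ^ 2 * Real.log ((m + θ) ^ 2)
      = 2 * (m + θ) ^ 2 * Real.log (m / (m + θ)) := by
    rw [Real.log_pow, Real.log_div hm0.ne' hs.ne']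
    push_cast
    ring
  have hup : 2 * (m + θ) ^ 2 * Real.log (m / (m + θ)) ≤ -(2 * (m + θ) * θ) := by
    have := Real.log_le_sub_one_of_pos (x := m / (m + θ)) (by positivity)
    calc _ ≤ 2 * (m + θ) ^ 2 * (m / (m + θ) - 1) := by gcongr
      _ = _ := by field_simp; ring
  have hlo : -(2 * (m + θ) * θ) - 4 ≤ 2 * (m + θ) ^ 2 * Real.log (m / (m + θ)) := by
    have := Real.one_sub_inv_le_log_of_pos (x := m / (m + θ)) (by positivity)
    calc -(2 * (m + θ) * θ) - 4 ≤ -(2 * (m + θ) * θ) - 2 * θ ^ 2 * (m + θ) / m := by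
          have : 2 * θ ^ 2 * (m + θ) / m ≤ 4 := by
            rw [div_le_iff₀ hm0]
            have : θ ^ 2 ≤ 1 := by nlinarith
            nlinarith
          linarith
      _ = 2 * (m + θ) ^ 2 * (1 - (m / (m + θ))⁻¹) := by field_simp; ring
      _ ≤ _ := by gcongr
  have e : (m + θ) ^ 2 / m - m - m ^ 2 + (m + θ) ^ 2 = 2 * (m + θ) * θ - θ ^ 2
      + (2 * θ + θ ^ 2 / m) := by
    field_simp
    ring
  have h5 : 0 ≤ θ ^ 2 / m := by positivity
  have h6 : θ ^ 2 / m ≤ 1 := by rw [div_le_one hm0]; nlinarith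
  have h7 : θ ^ 2 ≤ 1 := by nlinarith
  have h8 : 0 ≤ θ ^ 2 := by positivity
  rw [abs_le]
  constructor <;> linarith

lemma abs_divisorSum_sub_le_sq_log {x w : ℝ} (hw : 1 ≤ w) (hxw : x = w ^ 3) :
    |(divisorSum ⌊x⌋₊ : ℝ) - x * (Real.log x + 2 * eulerMascheroniConstant - 1)|
      ≤ 12021 * w * (1 + Real.log w) ^ 2 := by
  have hw0 : 0 < w := by linarith
  have hx1 : 1 ≤ x := by rw [hxw]; exact one_le_pow₀ hw
  set n := ⌊x⌋₊ with hn
  have hn1 : 1 ≤ n := Nat.one_le_floor_iff _ |>.2 hx1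
  set m := n.sqrt with hm
  have hmpos : 0 < m := Nat.sqrt_pos.2 hn1
  have hm1 : (1 : ℝ) ≤ m := by exact_mod_cast hmpos
  have hm2 : (m : ℝ) ^ 2 ≤ x := by
    have h1 : m ^ 2 ≤ n := Nat.sqrt_le' n
    calc (m : ℝ) ^ 2 ≤ n := by exact_mod_cast h1
      _ ≤ x := Nat.floor_le (by linarith)
  have hm3 : x < ((m : ℝ) + 1) ^ 2 := by
    have h1 : n + 1 ≤ (m + 1) ^ 2 := Nat.lt_succ_sqrt' n
    calc x < n + 1 := Nat.lt_floor_add_one x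
      _ ≤ _ := by exact_mod_cast h1
  have hS := abs_sum_saw_div_le_sq_log hw hxw m hm2
  set S := ∑ k ∈ Ico 1 (m + 1), saw (x / k) with hSdef
  have hIoc : Ioc 0 m = Ico 1 (m + 1) := by ext; simp only [Finset.mem_Ioc, Finset.mem_Ico]; omega
  have hD : (divisorSum n : ℝ) = 2 * x * harmonic m - 2 * S - m - m ^ 2 := by
    have h1 : (divisorSum n : ℝ) + m ^ 2 = 2 * ∑ k ∈ Ioc 0 m, ((n / k : ℕ) : ℝ) := by
      exact_mod_cast divisorSum_add_sqrt_sq n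
    have h2 : ∀ k ∈ Ioc 0 m, ((n / k : ℕ) : ℝ) = x * (k : ℝ)⁻¹ - saw (x / k) - 1 / 2 := by
      intro k _
      rw [hn, ← Nat.floor_div_natCast, natCast_floor_eq_intCast_floor (by positivity), saw,
        Int.fract]
      ring
    have h3 : (harmonic m : ℝ) = ∑ k ∈ Ico 1 (m + 1), (k : ℝ)⁻¹ := by
      rw [harmonic_eq_sum_Icc]
      push_cast
      rfl
    rw [Finset.sum_congr rfl h2, hIoc, Finset.sum_sub_distrib, Finset.sum_sub_distrib,
      ← Finset.mul_sum, ← h3, ← hSdef] at h1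
    simp only [sum_const, Nat.card_Ico, nsmul_eq_mul, Nat.add_sub_cancel] at h1
    linarith
  have hH := abs_le.1 (abs_harmonic_sub_log_sub_le m hmpos)
  have hxm : x * (1 / (m : ℝ) ^ 2) ≤ 4 := by
    rw [mul_one_div, div_le_iff₀ (by positivity)]
    nlinarith
  have hM := abs_le.1 (abs_hyperbola_main_le hmpos hm2 hm3)
  set R := (harmonic m : ℝ) - Real.log m - eulerMascheroniConstant - 1 / (2 * m) with hR
  have hR1 : |2 * x * R| ≤ 8 := by
    rw [abs_mul, abs_of_nonneg (by positivity)]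
    have : x * |R| ≤ x * (1 / (m : ℝ) ^ 2) := by
      gcongr
      exact abs_harmonic_sub_log_sub_le m hmpos
    linarith
  have e : (divisorSum n : ℝ) - x * (Real.log x + 2 * eulerMascheroniConstant - 1)
      = 2 * x * R - 2 * S
        + (2 * x * Real.log m + x / m - m - m ^ 2 - (x * Real.log x - x)) := by
    rw [hD, hR]
    field_simp
    ring
  have hlogw : 0 ≤ Real.log w := Real.log_nonneg hw
  have h1 : 1 ≤ w * (1 + Real.log w) ^ 2 := one_le_mul_of_one_le_of_one_le hw (by nlinarith)
  have h2 := abs_le.1 hS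
  have h3 := abs_le.1 hR1
  rw [e, abs_le]
  constructor <;> linarith

/-- The Dirichlet divisor problem with the Voronoi exponent `1/3`. -/
lemma exists_abs_divisorSum_sub_le {ε : ℝ} (hε : 0 < ε) :
    ∃ C, 0 ≤ C ∧ ∀ x : ℝ, 1 / 4 ≤ x →
      |(divisorSum ⌊x⌋₊ : ℝ) - x * (Real.log x + 2 * eulerMascheroniConstant - 1)|
        ≤ C * x ^ (1 / 3 + ε) := by
  set K : ℝ := 12021 * (1 + 2 / (3 * ε)) ^ 2 with hK
  have hK0 : 0 ≤ K := by positivity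
  refine ⟨K + 6 * 4 ^ (1 / 3 + ε), by positivity, fun x hx => ?_⟩
  have hx0 : 0 < x := by linarith
  have hxp : 0 < x ^ (1 / 3 + ε) := Real.rpow_pos_of_pos hx0 _
  rcases le_or_gt 1 x with h1 | h1
  · set w := x ^ (1 / 3 : ℝ) with hwdef
    have hw : 1 ≤ w := Real.one_le_rpow h1 (by norm_num)
    have hw0 : 0 < w := by linarith
    have hxw : x = w ^ 3 := by
      rw [hwdef, ← Real.rpow_natCast, ← Real.rpow_mul hx0.le]
      norm_num
    refine (abs_divisorSum_sub_le_sq_log hw hxw).trans ?_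
    have hlog : 1 + Real.log w ≤ (1 + 2 / (3 * ε)) * w ^ (3 * ε / 2) := by
      have h2 := Real.log_le_rpow_div hw0.le (ε := 3 * ε / 2) (by positivity)
      have h3 : 1 ≤ w ^ (3 * ε / 2) := Real.one_le_rpow hw (by positivity)
      calc 1 + Real.log w ≤ w ^ (3 * ε / 2) + w ^ (3 * ε / 2) / (3 * ε / 2) := add_le_add h3 h2
        _ = _ := by field_simp
    have hlogw : 0 ≤ Real.log w := Real.log_nonneg hw
    have hpow : w * (w ^ (3 * ε / 2)) ^ 2 = x ^ (1 / 3 + ε) := by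
      rw [← Real.rpow_natCast, ← Real.rpow_mul hw0.le, hwdef, ← Real.rpow_mul hx0.le,
        ← Real.rpow_add hx0]
      congr 1
      push_cast
      ring
    calc 12021 * w * (1 + Real.log w) ^ 2
        ≤ 12021 * w * ((1 + 2 / (3 * ε)) * w ^ (3 * ε / 2)) ^ 2 := by gcongr
      _ = K * x ^ (1 / 3 + ε) := by rw [← hpow, hK]; ring
      _ ≤ _ := by
          gcongr
          exact le_add_of_nonneg_right (by positivity)
  · have hfl : ⌊x⌋₊ = 0 := Nat.floor_eq_zero.2 h1
    have hlog1 : Real.log x ≤ 0 := Real.log_nonpos hx0.le h1.le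
    have hlog2 : -3 ≤ Real.log x := by
      have := Real.one_sub_inv_le_log_of_pos hx0
      have h2 : x⁻¹ ≤ 4 := by rw [inv_le_comm₀ hx0 (by norm_num)]; linarith
      linarith
    have hγ1 := one_half_lt_eulerMascheroniConstant
    have hγ2 := eulerMascheroniConstant_lt_two_thirds
    have hbd : |Real.log x + 2 * eulerMascheroniConstant - 1| ≤ 6 := by
      rw [abs_le]; constructor <;> linarith
    have h4 : 1 ≤ (4 : ℝ) ^ (1 / 3 + ε) * x ^ (1 / 3 + ε) := by
      rw [← Real.mul_rpow (by norm_num) hx0.le]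
      exact Real.one_le_rpow (by linarith) (by positivity)
    simp only [hfl, divisorSum, Ioc_self, sum_empty, Nat.cast_zero, zero_sub, abs_neg]
    rw [abs_mul, abs_of_pos hx0]
    calc x * |Real.log x + 2 * eulerMascheroniConstant - 1| ≤ 1 * 6 := by gcongr
      _ ≤ 6 * (4 ^ (1 / 3 + ε) * x ^ (1 / 3 + ε)) := by linarith
      _ ≤ (K + 6 * 4 ^ (1 / 3 + ε)) * x ^ (1 / 3 + ε) := by nlinarith

lemma d_two_pow_mul {j u : ℕ} (hu : Odd u) : d (2 ^ j * u) = (j + 1) * d u := by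
  have hcop : Nat.Coprime (2 ^ j) u := Nat.Coprime.pow_left j hu.coprime_two_left
  rw [d, d, hcop.card_divisors_mul, Nat.divisors_prime_pow Nat.prime_two, card_map, card_range]

lemma d_two_mul_add {m : ℕ} (hm : m ≠ 0) :
    d (2 * m) + (if 2 ∣ m then d (m / 2) else 0) = 2 * d m := by
  obtain ⟨j, u, hu, rfl⟩ := Nat.exists_eq_two_pow_mul_odd hm
  rw [← mul_assoc, ← pow_succ', d_two_pow_mul hu, d_two_pow_mul hu]
  rcases j with _ | j
  · have : ¬ 2 ∣ u := hu.not_two_dvd_nat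
    simp [this]
  · have h1 : 2 ^ (j + 1) * u = 2 * (2 ^ j * u) := by ring
    rw [h1, if_pos (Dvd.intro _ rfl), Nat.mul_div_cancel_left _ two_pos, d_two_pow_mul hu]
    ring

lemma sum_Ioc_ite_two_dvd {R : Type*} [AddCommMonoid R] (f : ℕ → R) (n : ℕ) :
    ∑ k ∈ Ioc 0 n, (if 2 ∣ k then f (k / 2) else 0) = ∑ m ∈ Ioc 0 (n / 2), f m := by
  induction n with
  | zero => simp
  | succ n ih =>
    rw [Finset.sum_Ioc_succ_top (Nat.zero_le n), ih]
    split_ifs with h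
    · have h1 : (n + 1) / 2 = n / 2 + 1 := by omega
      rw [h1, Finset.sum_Ioc_succ_top (Nat.zero_le _)]
    · have h1 : (n + 1) / 2 = n / 2 := by omega
      rw [h1, add_zero]

lemma sum_d_two_mul_add (n : ℕ) :
    ∑ m ∈ Ioc 0 n, d (2 * m) + divisorSum (n / 2) = 2 * divisorSum n := by
  rw [divisorSum, divisorSum, ← sum_Ioc_ite_two_dvd, ← Finset.sum_add_distrib, Finset.mul_sum]
  exact Finset.sum_congr rfl fun m hm => d_two_mul_add (Finset.mem_Ioc.1 hm).1.ne'

lemma sum_neg_one_pow_mul_d (n : ℕ) :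
    ∑ k ∈ Ioc 0 n, (-1 : ℝ) ^ k * (d k : ℝ)
      = 4 * divisorSum (n / 2) - 2 * divisorSum (n / 4) - divisorSum n := by
  have h1 : ∑ k ∈ Ioc 0 n, (-1 : ℝ) ^ k * (d k : ℝ) + divisorSum n
      = ∑ k ∈ Ioc 0 n, (if 2 ∣ k then 2 * (d (2 * (k / 2)) : ℝ) else 0) := by
    rw [divisorSum, Nat.cast_sum, ← Finset.sum_add_distrib]
    refine Finset.sum_congr rfl fun k _ => ?_
    split_ifs with h
    · rw [Nat.mul_div_cancel' h, (even_iff_two_dvd.2 h).neg_one_pow]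
      ring
    · rw [(Nat.not_even_iff_odd.1 fun h' => h (even_iff_two_dvd.1 h')).neg_one_pow]
      ring
  rw [sum_Ioc_ite_two_dvd (fun m => 2 * (d (2 * m) : ℝ)), ← Finset.mul_sum] at h1
  have h2 : ∑ m ∈ Ioc 0 (n / 2), (d (2 * m) : ℝ) + divisorSum (n / 4)
      = 2 * divisorSum (n / 2) := by
    have := sum_d_two_mul_add (n / 2)
    rw [Nat.div_div_eq_div_mul] at this
    exact_mod_cast this
  linarith

lemma exists_abs_sum_neg_one_pow_mul_d_sub_le {ε : ℝ} (hε : 0 < ε) :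
    ∃ C, 0 ≤ C ∧ ∀ x : ℝ, 1 ≤ x →
      |∑ k ∈ Icc 0 ⌊x⌋₊, (-1 : ℝ) ^ k * (d k : ℝ)
          - x * (Real.log x / 2 + (eulerMascheroniConstant - 1 / 2 - Real.log 2))|
        ≤ C * x ^ (1 / 3 + ε) := by
  obtain ⟨C, hC, h⟩ := exists_abs_divisorSum_sub_le hε
  refine ⟨7 * C, by positivity, fun x hx => ?_⟩
  have hx0 : 0 < x := by linarith
  have hD : ∑ k ∈ Icc 0 ⌊x⌋₊, (-1 : ℝ) ^ k * (d k : ℝ)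
      = 4 * divisorSum ⌊x / 2⌋₊ - 2 * divisorSum ⌊x / 4⌋₊ - divisorSum ⌊x⌋₊ := by
    rw [Finset.Icc_eq_cons_Ioc (Nat.zero_le _), Finset.sum_cons, sum_neg_one_pow_mul_d,
      Nat.floor_div_ofNat, Nat.floor_div_ofNat]
    simp [d]
  have h1 := h x (by linarith)
  have h2 := h (x / 2) (by linarith)
  have h4 := h (x / 4) (by linarith)
  have e2 : Real.log (x / 2) = Real.log x - Real.log 2 := Real.log_div hx0.ne' two_ne_zero
  have e4 : Real.log (x / 4) = Real.log x - 2 * Real.log 2 := by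
    rw [Real.log_div hx0.ne' four_ne_zero, show (4 : ℝ) = 2 ^ 2 by norm_num, Real.log_pow]
    norm_num
  have m2 : C * (x / 2) ^ (1 / 3 + ε) ≤ C * x ^ (1 / 3 + ε) := by gcongr; linarith
  have m4 : C * (x / 4) ^ (1 / 3 + ε) ≤ C * x ^ (1 / 3 + ε) := by gcongr; linarith
  have h1' := abs_le.1 h1
  have h2' := abs_le.1 (h2.trans m2)
  have h4' := abs_le.1 (h4.trans m4)
  rw [e2] at h2'
  rw [e4] at h4'
  rw [hD, abs_le]
  constructor <;> linarith

lemma integral_sqrt_mul_log (κ : ℝ) {x : ℝ} (hx : 1 ≤ x) :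
    IntegrableOn (fun t : ℝ => t ^ (1 / 2 : ℝ) * (Real.log t / 4 + κ / 2)) (Set.Ioc 1 x) ∧
    ∫ t in Set.Ioc 1 x, t ^ (1 / 2 : ℝ) * (Real.log t / 4 + κ / 2)
      = x ^ (3 / 2 : ℝ) * (Real.log x / 6 - 1 / 9 + κ / 3) - (-1 / 9 + κ / 3) := by
  have hpos : ∀ t ∈ Set.uIcc 1 x, 0 < t := fun t ht => by
    rw [Set.uIcc_of_le hx] at ht; linarith [ht.1]
  have hcont : ContinuousOn (fun t : ℝ => t ^ (1 / 2 : ℝ) * (Real.log t / 4 + κ / 2))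
      (Set.uIcc 1 x) := by
    refine ContinuousOn.mul (continuousOn_id.rpow_const fun t ht => Or.inl (hpos t ht).ne') ?_
    refine ContinuousOn.add (ContinuousOn.div_const ?_ _) continuousOn_const
    exact Real.continuousOn_log.mono fun t ht => (hpos t ht).ne'
  have hint := hcont.intervalIntegrable (μ := volume)
  refine ⟨(intervalIntegrable_iff_integrableOn_Ioc_of_le hx).1 hint, ?_⟩
  rw [← intervalIntegral.integral_of_le hx, intervalIntegral.integral_eq_sub_of_hasDerivAt
    (f := fun t => t ^ (3 / 2 : ℝ) * (Real.log t / 6 - 1 / 9 + κ / 3)) _ hint]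
  · norm_num
  · intro t ht
    have ht0 := hpos t ht
    have h1 := (Real.hasDerivAt_rpow_const (x := t) (p := 3 / 2) (Or.inl ht0.ne'))
    have h2 := (((Real.hasDerivAt_log ht0.ne').div_const 6).sub_const (1 / 9)).add_const (κ / 3)
    convert! h1.mul h2 using 1
    have e : t ^ (3 / 2 : ℝ) = t ^ (1 / 2 : ℝ) * t := by
      rw [← Real.rpow_add_one ht0.ne']; norm_num
    rw [e, show (3 / 2 : ℝ) - 1 = 1 / 2 by norm_num]
    field_simp
    ring

theorem stmt8 (ε : ℝ) (hε : 0 < ε) :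
    (fun x : ℝ =>
        (∑ k ∈ Finset.Icc 1 ⌊x⌋₊, (-1 : ℝ) ^ k * (d k : ℝ) * (k : ℝ) ^ ((1:ℝ)/2)) -
          (1 / 3) * x ^ ((3:ℝ)/2) *
            (Real.log x + 2 * Real.eulerMascheroniConstant - 2 * Real.log 2 - 2 / 3))
      =O[atTop] fun x : ℝ => x ^ ((5:ℝ)/6 + ε) := by
  obtain ⟨C, hC, hA⟩ := exists_abs_sum_neg_one_pow_mul_d_sub_le hε
  set κ : ℝ := eulerMascheroniConstant - 1 / 2 - Real.log 2 with hκ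
  set c : ℕ → ℝ := fun k => (-1 : ℝ) ^ k * (d k : ℝ) with hc
  have hc0 : c 0 = 0 := by simp [hc, d]
  refine Asymptotics.IsBigO.of_bound (2 * C + |-1 / 9 + κ / 3|) ?_
  filter_upwards [eventually_ge_atTop 1] with x hx
  have hx0 : 0 < x := by linarith
  have hderiv : ∀ t : ℝ, 0 < t →
      deriv (fun t : ℝ => t ^ (1 / 2 : ℝ)) t = 1 / 2 * t ^ (-1 / 2 : ℝ) := fun t ht => by
    rw [Real.deriv_rpow_const]
    norm_num
  have hcontneg (p : ℝ) : ContinuousOn (fun t : ℝ => t ^ p) (Set.Icc 1 x) :=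
    continuousOn_id.rpow_const fun t ht => Or.inl (by
      have := ht.1
      simp only [id]
      linarith)
  have hdint : IntegrableOn (deriv fun t : ℝ => t ^ (1 / 2 : ℝ)) (Set.Icc 1 x) := by
    have h1 : ContinuousOn (fun t : ℝ => 1 / 2 * t ^ (-1 / 2 : ℝ)) (Set.Icc 1 x) :=
      continuousOn_const.mul (hcontneg _)
    refine (h1.integrableOn_Icc).congr_fun (fun t ht => ?_) measurableSet_Icc
    exact (hderiv t (by linarith [ht.1])).symm
  have habel := sum_mul_eq_sub_integral_mul₀ (f := fun t : ℝ => t ^ (1 / 2 : ℝ)) c hc0 x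
    (fun t ht => (Real.differentiableAt_rpow_const_of_ne _ (by linarith [ht.1]))) hdint
  have hsum : ∑ k ∈ Finset.Icc 1 ⌊x⌋₊, (-1 : ℝ) ^ k * (d k : ℝ) * (k : ℝ) ^ ((1:ℝ)/2)
      = ∑ k ∈ Finset.Icc 0 ⌊x⌋₊, (k : ℝ) ^ (1 / 2 : ℝ) * c k := by
    rw [Finset.Icc_eq_cons_Ioc (Nat.zero_le _), Finset.sum_cons, hc0, mul_zero, zero_add]
    exact Finset.sum_congr rfl fun k _ => mul_comm _ _
  set A : ℝ → ℝ := fun t => ∑ k ∈ Icc 0 ⌊t⌋₊, c k with hAdef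
  obtain ⟨hGint, hG⟩ := integral_sqrt_mul_log κ hx
  have hAint : IntegrableOn (fun t => deriv (fun t : ℝ => t ^ (1 / 2 : ℝ)) t * A t)
      (Set.Ioc 1 x) :=
    (integrableOn_mul_sum_Icc c (m := 0) zero_le_one hdint).mono_set Set.Ioc_subset_Icc_self
  have herr : |∫ t in Set.Ioc 1 x, (deriv (fun t : ℝ => t ^ (1 / 2 : ℝ)) t * A t
      - t ^ (1 / 2 : ℝ) * (Real.log t / 4 + κ / 2))| ≤ C * x ^ (5 / 6 + ε) := by
    have hbint : IntegrableOn (fun t : ℝ => C / 2 * t ^ (-1 / 6 + ε)) (Set.Ioc 1 x) :=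
      ((continuousOn_const.mul (hcontneg _)).integrableOn_Icc).mono_set Set.Ioc_subset_Icc_self
    have hle : ∀ t ∈ Set.Ioc 1 x, ‖deriv (fun t : ℝ => t ^ (1 / 2 : ℝ)) t * A t
        - t ^ (1 / 2 : ℝ) * (Real.log t / 4 + κ / 2)‖ ≤ C / 2 * t ^ (-1 / 6 + ε) := by
      intro t ht
      have ht0 : 0 < t := by linarith [ht.1]
      have e1 : t ^ (1 / 2 : ℝ) = t ^ (-1 / 2 : ℝ) * t := by
        rw [← Real.rpow_add_one ht0.ne']; norm_num
      have e2 : t ^ (-1 / 6 + ε) = t ^ (-1 / 2 : ℝ) * t ^ (1 / 3 + ε) := by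
        rw [← Real.rpow_add ht0]; congr 1; ring
      have e3 : 1 / 2 * t ^ (-1 / 2 : ℝ) * A t
          - t ^ (-1 / 2 : ℝ) * t * (Real.log t / 4 + κ / 2)
          = 1 / 2 * t ^ (-1 / 2 : ℝ) * (A t - t * (Real.log t / 2 + κ)) := by ring
      rw [hderiv t ht0, e1, e2, e3, Real.norm_eq_abs, abs_mul, abs_of_nonneg (by positivity)]
      calc _ ≤ 1 / 2 * t ^ (-1 / 2 : ℝ) * (C * t ^ (1 / 3 + ε)) := by
            gcongr
            exact hA t ht.1.le
        _ = _ := by ring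
    have h1 := norm_integral_le_of_norm_le hbint
      ((ae_restrict_iff' measurableSet_Ioc).2 (Eventually.of_forall hle))
    rw [Real.norm_eq_abs] at h1
    refine h1.trans ?_
    rw [← intervalIntegral.integral_of_le hx, intervalIntegral.integral_const_mul,
      integral_rpow (Or.inl (by linarith)), Real.one_rpow,
      show -1 / 6 + ε + 1 = 5 / 6 + ε by ring]
    have h2 : 0 ≤ x ^ (5 / 6 + ε) := by positivity
    have h3 : (x ^ (5 / 6 + ε) - 1) / (5 / 6 + ε) ≤ 2 * x ^ (5 / 6 + ε) := by
      rw [div_le_iff₀ (by linarith)]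
      nlinarith
    calc _ ≤ C / 2 * (2 * x ^ (5 / 6 + ε)) := by gcongr
      _ = _ := by ring
  rw [integral_sub hAint hGint, hG] at herr
  have hhead : |x ^ (1 / 2 : ℝ) * (A x - x * (Real.log x / 2 + κ))| ≤ C * x ^ (5 / 6 + ε) := by
    rw [abs_mul, abs_of_nonneg (by positivity)]
    calc _ ≤ x ^ (1 / 2 : ℝ) * (C * x ^ (1 / 3 + ε)) := by
          gcongr
          exact hA x hx
      _ = C * (x ^ (1 / 2 : ℝ) * x ^ (1 / 3 + ε)) := by ring
      _ = _ := by rw [← Real.rpow_add hx0]; congr 2; ring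
  have hone : 1 ≤ x ^ (5 / 6 + ε) := Real.one_le_rpow hx (by linarith)
  have e : x ^ (3 / 2 : ℝ) = x ^ (1 / 2 : ℝ) * x := by
    rw [← Real.rpow_add_one hx0.ne']; norm_num
  have hconst : |-1 / 9 + κ / 3| ≤ |-1 / 9 + κ / 3| * x ^ (5 / 6 + ε) :=
    le_mul_of_one_le_right (abs_nonneg _) hone
  have hfinal : (∑ k ∈ Finset.Icc 1 ⌊x⌋₊, (-1 : ℝ) ^ k * (d k : ℝ) * (k : ℝ) ^ ((1:ℝ)/2)) -
      (1 / 3) * x ^ ((3:ℝ)/2) *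
        (Real.log x + 2 * Real.eulerMascheroniConstant - 2 * Real.log 2 - 2 / 3)
      = x ^ (1 / 2 : ℝ) * (A x - x * (Real.log x / 2 + κ))
        - ((∫ t in Set.Ioc 1 x, deriv (fun t : ℝ => t ^ (1 / 2 : ℝ)) t * A t)
          - (x ^ (3 / 2 : ℝ) * (Real.log x / 6 - 1 / 9 + κ / 3) - (-1 / 9 + κ / 3)))
        + (-1 / 9 + κ / 3) := by
    rw [hsum, habel, e, hκ]
    ring
  rw [hfinal, Real.norm_eq_abs, Real.norm_eq_abs, abs_of_nonneg (zero_le_one.trans hone)]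
  refine (abs_add_le _ _).trans ?_
  refine (add_le_add_left (abs_sub _ _) _).trans ?_
  linarith
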